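/- Let m be a positive integer, α = (α₁, …, α_m) an m-tuple of real numbers, and n ≥ 2 an integer. For a positive integer q define ℓ(q) = √(Σ_{i=1}^m ‖qαᵢ‖²), and say q has type s ∈ {+,−}^m where the i-th sign is + if {qαᵢ} ≥ 1/2 and − otherwise; two types are opposite if they differ in every coordinate. Let Q₁ be the least integer in {1, …, ⌊n/2⌋} with ℓ(Q₁) ≤ ℓ(q) for all integers 1 ≤ q ≤ n/2. Let Q₁^⊥ = { q : 1 ≤ q ≤ n − Q₁, q does not have the same type as Q₁ }, assume Q₁^⊥ is nonempty, and let Q₂ be the least integer in Q₁^⊥ with ℓ(Q₂) ≤ ℓ(q) for all q ∈ Q₁^⊥. Then the set { ℓ(q) : q an integer, n − Q₁ < q ≤ n, the type of q is opposite to the type of Q₁, and ℓ(q) < ℓ(Q₂) } has at most ⌈√m⌉^m · (⌈√(2m)⌉^m + 1) elements. -/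

import Mathlib

open scoped Classical

/-- `nint x` is the distance from the real number `x` to the nearest integer. -/
noncomputable def nint (x : ℝ) : ℝ := |x - round x|

/-- `lenm α q = √(Σᵢ ‖qαᵢ‖²)`, the length of the integer `q` w.r.t. `α : Fin m → ℝ`. -/
noncomputable def lenm {m : ℕ} (α : Fin m → ℝ) (q : ℕ) : ℝ :=
  Real.sqrt (∑ i, nint ((q : ℝ) * α i) ^ 2)

/-- The type of the integer `q` w.r.t. `α : Fin m → ℝ`: the `m`-tuple of signs of
`{qαᵢ} − 1/2` (`true` = `+`, `false` = `−`). -/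
noncomputable def typm {m : ℕ} (α : Fin m → ℝ) (q : ℕ) : Fin m → Bool :=
  fun i => if 1 / 2 ≤ Int.fract ((q : ℝ) * α i) then true else false

theorem nint_nonneg (x : ℝ) : 0 ≤ nint x := abs_nonneg _

theorem nint_eq_min_fract (x : ℝ) : nint x = min (Int.fract x) (1 - Int.fract x) :=
  abs_sub_round_eq_min x

theorem fract_sub_eq (a b : ℝ) :
    (Int.fract b ≤ Int.fract a ∧ Int.fract (a - b) = Int.fract a - Int.fract b) ∨
      (Int.fract a < Int.fract b ∧ Int.fract (a - b) = Int.fract a - Int.fract b + 1) := by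
  have ha := Int.fract_nonneg a
  have hb := Int.fract_nonneg b
  have ha' := Int.fract_lt_one a
  have hb' := Int.fract_lt_one b
  have ea := Int.floor_add_fract a
  have eb := Int.floor_add_fract b
  rcases le_or_gt (Int.fract b) (Int.fract a) with h | h
  · refine Or.inl ⟨h, Int.fract_eq_iff.2 ⟨by linarith, by linarith, ⌊a⌋ - ⌊b⌋, ?_⟩⟩
    push_cast
    linarith
  · refine Or.inr ⟨h, Int.fract_eq_iff.2 ⟨by linarith, by linarith, ⌊a⌋ - ⌊b⌋ - 1, ?_⟩⟩
    push_cast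
    linarith

theorem nint_sub_eq {a b : ℝ} (h : 1 / 2 ≤ Int.fract a ↔ 1 / 2 ≤ Int.fract b) :
    nint (a - b) = |nint a - nint b| := by
  have ha := Int.fract_nonneg a
  have hb := Int.fract_nonneg b
  have ha' := Int.fract_lt_one a
  have hb' := Int.fract_lt_one b
  simp only [nint_eq_min_fract]
  rcases fract_sub_eq a b with ⟨_, h'⟩ | ⟨_, h'⟩ <;> rw [h'] <;> grind

theorem nint_le_nint_of_sub {a b : ℝ} (h : 1 / 2 ≤ Int.fract a ↔ 1 / 2 ≤ Int.fract b)
    (hs : 1 / 2 ≤ Int.fract (a - b) ↔ 1 / 2 ≤ Int.fract a) : nint b ≤ nint a := by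
  have ha := Int.fract_nonneg a
  have hb := Int.fract_nonneg b
  have ha' := Int.fract_lt_one a
  have hb' := Int.fract_lt_one b
  simp only [nint_eq_min_fract]
  rcases fract_sub_eq a b with ⟨_, h'⟩ | ⟨_, h'⟩ <;> rw [h'] at hs <;> grind

section

variable {m : ℕ} {α : Fin m → ℝ}

theorem lenm_nonneg (q : ℕ) : 0 ≤ lenm α q := Real.sqrt_nonneg _

theorem lenm_sq (q : ℕ) : lenm α q ^ 2 = ∑ i, nint ((q : ℝ) * α i) ^ 2 :=
  Real.sq_sqrt (Finset.sum_nonneg fun _ _ => sq_nonneg _)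

theorem nint_le_lenm (q : ℕ) (i : Fin m) : nint ((q : ℝ) * α i) ≤ lenm α q :=
  Real.le_sqrt_of_sq_le <|
    Finset.single_le_sum (f := fun i => nint ((q : ℝ) * α i) ^ 2) (fun _ _ => sq_nonneg _)
      (Finset.mem_univ i)

theorem typm_apply_eq_iff {p q : ℕ} {i : Fin m} : typm α p i = typm α q i ↔
    (1 / 2 ≤ Int.fract ((p : ℝ) * α i) ↔ 1 / 2 ≤ Int.fract ((q : ℝ) * α i)) := by
  unfold typm
  split_ifs <;> tauto

/-- The squared length of a difference of two integers of the same type. -/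
theorem lenm_sub_sq {p q : ℕ} (hpq : p ≤ q) (ht : typm α p = typm α q) :
    lenm α (q - p) ^ 2 = ∑ i, (nint ((q : ℝ) * α i) - nint ((p : ℝ) * α i)) ^ 2 := by
  rw [lenm_sq]
  refine Finset.sum_congr rfl fun i _ => ?_
  rw [Nat.cast_sub hpq, sub_mul, nint_sub_eq (typm_apply_eq_iff.1 (congrFun ht i).symm), sq_abs]

theorem lenm_sub_sq_le {p q : ℕ} (hpq : p ≤ q) (ht : typm α p = typm α q) :
    lenm α (q - p) ^ 2 ≤ lenm α q ^ 2 + lenm α p ^ 2 := by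
  rw [lenm_sub_sq hpq ht, lenm_sq, lenm_sq, ← Finset.sum_add_distrib]
  refine Finset.sum_le_sum fun i _ => ?_
  nlinarith [mul_nonneg (nint_nonneg ((q : ℝ) * α i)) (nint_nonneg ((p : ℝ) * α i))]

theorem lenm_le_lenm_of_typm_sub {p q : ℕ} (hpq : p ≤ q) (ht : typm α p = typm α q)
    (hs : typm α (q - p) = typm α q) : lenm α p ≤ lenm α q := by
  refine Real.sqrt_le_sqrt (Finset.sum_le_sum fun i _ => ?_)
  refine pow_le_pow_left₀ (nint_nonneg _) ?_ 2
  refine nint_le_nint_of_sub (typm_apply_eq_iff.1 (congrFun ht i).symm) ?_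
  rw [← sub_mul, ← Nat.cast_sub hpq]
  exact typm_apply_eq_iff.1 (congrFun hs i)

/-- A subset of the cube `[0, r)^m` whose points are at pairwise distance at least `r / √2` has at
most `⌈√(2m)⌉^m` points. -/
theorem ncard_le_of_separated {ι : Type*} (hm : 1 ≤ m) (S : Set ι) (u : ι → Fin m → ℝ) (r : ℝ)
    (h0 : ∀ p ∈ S, ∀ i, 0 ≤ u p i) (hr : ∀ p ∈ S, ∀ i, u p i < r)
    (hsep : ∀ p ∈ S, ∀ q ∈ S, p ≠ q → r ^ 2 ≤ 2 * ∑ i, (u q i - u p i) ^ 2) :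
    S.ncard ≤ ⌈Real.sqrt (2 * m)⌉₊ ^ m := by
  set K := ⌈Real.sqrt (2 * m)⌉₊
  have hm0 : (0 : ℝ) < m := by exact_mod_cast hm
  have hK : Real.sqrt (2 * m) ≤ K := Nat.le_ceil _
  have hK0 : (0 : ℝ) < K := (Real.sqrt_pos.2 (by positivity)).trans_le hK
  have hK2 : (2 * m : ℝ) ≤ (K : ℝ) ^ 2 := (Real.sqrt_le_left hK0.le).1 hK
  have hrpos : ∀ p ∈ S, 0 < r := fun p hp => (h0 p hp ⟨0, hm⟩).trans_lt (hr p hp ⟨0, hm⟩)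
  let T : Finset (Fin m → ℕ) := Fintype.piFinset fun _ => Finset.range K
  have hT : (T : Set (Fin m → ℕ)).ncard = K ^ m := by
    rw [Set.ncard_coe_finset]
    simp [T]
  rw [← hT]
  refine Set.ncard_le_ncard_of_injOn (fun p i => ⌊u p i * K / r⌋₊) ?_ ?_ T.finite_toSet
  · intro p hp
    have hr0 := hrpos p hp
    simp only [T, Finset.mem_coe, Fintype.mem_piFinset, Finset.mem_range]
    intro i
    have hu := h0 p hp i
    rw [Nat.floor_lt (by positivity), div_lt_iff₀ hr0, mul_comm]
    exact mul_lt_mul_of_pos_left (hr p hp i) hK0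
  · intro p hp q hq hpq
    by_contra hne
    have hr0 := hrpos p hp
    have hlt : ∀ i, (u q i - u p i) ^ 2 < r ^ 2 / (K : ℝ) ^ 2 := by
      intro i
      have hfl : ⌊u p i * K / r⌋₊ = ⌊u q i * K / r⌋₊ := congrFun hpq i
      have hup := h0 p hp i
      have huq := h0 q hq i
      have h1 := Nat.floor_le (show 0 ≤ u p i * K / r by positivity)
      have h2 := Nat.lt_floor_add_one (u p i * K / r)
      have h3 := Nat.floor_le (show 0 ≤ u q i * K / r by positivity)
      have h4 := Nat.lt_floor_add_one (u q i * K / r)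
      rw [hfl] at h1 h2
      have h5 : |(u q i - u p i) * K / r| < 1 := by
        rw [sub_mul, sub_div, abs_lt]
        constructor <;> linarith
      have h6 := (sq_lt_one_iff_abs_lt_one _).2 h5
      rw [div_pow, mul_pow, div_lt_one (by positivity)] at h6
      rwa [lt_div_iff₀ (by positivity)]
    have hsum : ∑ i, (u q i - u p i) ^ 2 < m * (r ^ 2 / (K : ℝ) ^ 2) := by
      have h := Finset.sum_lt_sum_of_nonempty
        (s := (Finset.univ : Finset (Fin m))) ⟨⟨0, hm⟩, Finset.mem_univ _⟩ fun i _ => hlt i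
      simpa using h
    have hle : 2 * (m * (r ^ 2 / (K : ℝ) ^ 2)) ≤ r ^ 2 := by
      rw [← mul_assoc, mul_div_assoc', div_le_iff₀ (by positivity), mul_comm]
      exact mul_le_mul_of_nonneg_left hK2 (sq_nonneg r)
    linarith [hsep p hp q hq hne]

end

/-- Case 2 of the proof of the paper's higher-dimensional theorem: with `Q₁` the least
minimiser of `ℓ` on `{1, …, ⌊n/2⌋}` and `Q₂` the least minimiser of `ℓ` on
`Q₁^⊥ = {1 ≤ q ≤ n − Q₁ : q` not of the same type as `Q₁}`, the lengths of secondary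
denominators (`n − Q₁ < q ≤ n` of type opposite to `Q₁` with `ℓ(q) < ℓ(Q₂)`) take at most
`⌈√m⌉^m (⌈√(2m)⌉^m + 1)` distinct values. -/
theorem secondary_lengths_count (m : ℕ) (hm : 1 ≤ m) (α : Fin m → ℝ)
    (n : ℕ) (hn : 2 ≤ n) (Q₁ Q₂ : ℕ)
    (hQ₁ : IsLeast {q : ℕ | (1 ≤ q ∧ 2 * q ≤ n) ∧
      ∀ q' : ℕ, 1 ≤ q' → 2 * q' ≤ n → lenm α q ≤ lenm α q'} Q₁)
    (hperp : {q : ℕ | 1 ≤ q ∧ q ≤ n - Q₁ ∧ typm α q ≠ typm α Q₁}.Nonempty)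
    (hQ₂ : IsLeast {q : ℕ | (1 ≤ q ∧ q ≤ n - Q₁ ∧ typm α q ≠ typm α Q₁) ∧
      ∀ q' : ℕ, 1 ≤ q' → q' ≤ n - Q₁ → typm α q' ≠ typm α Q₁ →
        lenm α q ≤ lenm α q'} Q₂) :
    Set.ncard {x : ℝ | ∃ q : ℕ, n - Q₁ < q ∧ q ≤ n ∧
      (∀ i, typm α q i = !(typm α Q₁ i)) ∧ lenm α q < lenm α Q₂ ∧ x = lenm α q}
      ≤ ⌈Real.sqrt m⌉₊ ^ m * (⌈Real.sqrt (2 * m)⌉₊ ^ m + 1) := by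
  obtain ⟨⟨⟨hQpos, hQn⟩, hQmin⟩, hQleast⟩ := hQ₁
  have hQ₂min := hQ₂.1.2
  have hlt : ∀ d, 1 ≤ d → d < Q₁ → lenm α Q₁ < lenm α d := by
    intro d hd hdQ
    by_contra! hle
    exact hdQ.not_ge <| hQleast ⟨⟨hd, by omega⟩, fun q' h1 h2 => hle.trans (hQmin q' h1 h2)⟩
  have hdiff : ∀ d, 1 ≤ d → d < Q₁ → lenm α Q₂ ^ 2 ≤ 2 * lenm α d ^ 2 := by
    intro d hd hdQ
    have h1 := pow_le_pow_left₀ (lenm_nonneg Q₁) (hlt d hd hdQ).le 2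
    by_cases ht : typm α d = typm α Q₁
    · have hs : typm α (Q₁ - d) ≠ typm α Q₁ := fun hs =>
        (hlt d hd hdQ).not_ge (lenm_le_lenm_of_typm_sub hdQ.le ht hs)
      have h2 := pow_le_pow_left₀ (lenm_nonneg Q₂) (hQ₂min _ (by omega) (by omega) hs) 2
      linarith [lenm_sub_sq_le hdQ.le ht]
    · have h2 := pow_le_pow_left₀ (lenm_nonneg Q₂) (hQ₂min d hd (by omega) ht) 2
      linarith [sq_nonneg (lenm α d)]
  let S : Set ℕ := {q | n - Q₁ < q ∧ q ≤ n ∧ (∀ i, typm α q i = !(typm α Q₁ i)) ∧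
    lenm α q < lenm α Q₂}
  have hS : S.Finite := (Set.finite_Iic n).subset fun q hq => hq.2.1
  have hsep : ∀ p ∈ S, ∀ q ∈ S, p < q → lenm α Q₂ ^ 2 ≤
      2 * ∑ i, (nint ((q : ℝ) * α i) - nint ((p : ℝ) * α i)) ^ 2 := by
    rintro p ⟨hp, -, hpt, -⟩ q ⟨-, hq, hqt, -⟩ hpq
    rw [← lenm_sub_sq hpq.le (funext fun i => (hpt i).trans (hqt i).symm)]
    exact hdiff (q - p) (by omega) (by omega)
  have hcard : S.ncard ≤ ⌈Real.sqrt (2 * m)⌉₊ ^ m := by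
    refine ncard_le_of_separated hm S (fun q i => nint ((q : ℝ) * α i)) (lenm α Q₂)
      (fun _ _ _ => nint_nonneg _) (fun q hq i => (nint_le_lenm q i).trans_lt hq.2.2.2) ?_
    intro p hp q hq hne
    rcases hne.lt_or_gt with h | h
    · exact hsep p hp q hq h
    · refine (hsep q hq p hp h).trans_eq ?_
      simp only [sub_sq_comm]
  have himage : {x : ℝ | ∃ q : ℕ, n - Q₁ < q ∧ q ≤ n ∧ (∀ i, typm α q i = !(typm α Q₁ i)) ∧
      lenm α q < lenm α Q₂ ∧ x = lenm α q} = lenm α '' S := by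
    ext x
    constructor
    · rintro ⟨q, h1, h2, h3, h4, rfl⟩
      exact ⟨q, ⟨h1, h2, h3, h4⟩, rfl⟩
    · rintro ⟨q, ⟨h1, h2, h3, h4⟩, rfl⟩
      exact ⟨q, h1, h2, h3, h4, rfl⟩
  have hone : 1 ≤ ⌈Real.sqrt m⌉₊ ^ m :=
    Nat.one_le_pow _ _ (Nat.ceil_pos.2 (Real.sqrt_pos.2 (by exact_mod_cast hm)))
  rw [himage]
  calc (lenm α '' S).ncard ≤ S.ncard := Set.ncard_image_le hS
    _ ≤ ⌈Real.sqrt (2 * m)⌉₊ ^ m + 1 := hcard.trans (Nat.le_succ _)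
    _ ≤ _ := Nat.le_mul_of_pos_left _ hone
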